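/- arXiv:0808.4134 — 6 statements merged into one kernel-verified Lean document; each statement's English description precedes it below -/
import Mathlib

section
/- Let L be the Laplacian matrix of a connected unweighted graph G on vertex set V, let L̃ be the Laplacian matrix of a weighted graph G̃ on the same vertex set, and let D be the diagonal matrix of degrees of G. Suppose (1) the second-smallest eigenvalue of D^{-1/2} L D^{-1/2} is at least λ > 0, and (2) the spectral norm of D^{-1/2}(L − L̃)D^{-1/2} is at most ε, where 0 ≤ ε < λ. Then G̃ is a σ-spectral approximation of G for σ = λ/(λ − ε). -/
open Matrix

/-- The Laplacian matrix of a weighted graph given by a symmetric, nonnegative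
weight function with zero diagonal: `L(u,v) = -w(u,v)` off the diagonal and
`L(u,u) = ∑_z w(u,z)`. -/
noncomputable def weightedLap {n : ℕ} (w : Fin n → Fin n → ℝ) :
    Matrix (Fin n) (Fin n) ℝ :=
  Matrix.of fun i j => if i = j then ∑ z, w i z else - w i j

theorem aux_gap {n : ℕ} (N : Matrix (Fin n) (Fin n) ℝ) (hN : N.IsHermitian) (lam : ℝ)
    (heig : ∀ μ ∈ spectrum ℝ N, μ ≠ 0 → lam ≤ μ) (y : Fin n → ℝ)
    (hy : ∀ v : Fin n → ℝ, N *ᵥ v = 0 → v ⬝ᵥ y = 0) :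
    lam * (y ⬝ᵥ y) ≤ y ⬝ᵥ (N *ᵥ y) := by
  have key : ∀ z : Fin n → ℝ, y ⬝ᵥ z =
      ∑ i, ((hN.eigenvectorBasis i : Fin n → ℝ) ⬝ᵥ y) *
        ((hN.eigenvectorBasis i : Fin n → ℝ) ⬝ᵥ z) := by
    intro z
    have h := hN.eigenvectorBasis.sum_inner_mul_inner (WithLp.toLp 2 y) (WithLp.toLp 2 z)
    simp only [EuclideanSpace.inner_eq_star_dotProduct, star_trivial] at h
    rw [dotProduct_comm, ← h]
    refine Finset.sum_congr rfl fun i _ => ?_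
    rw [dotProduct_comm z]
  have hsymm : Nᵀ = N := by simpa [Matrix.IsHermitian] using hN
  have h2 : ∀ i, (hN.eigenvectorBasis i : Fin n → ℝ) ⬝ᵥ (N *ᵥ y) =
      hN.eigenvalues i * ((hN.eigenvectorBasis i : Fin n → ℝ) ⬝ᵥ y) := by
    intro i
    have h := hN.mulVec_eigenvectorBasis i
    rw [dotProduct_mulVec, ← mulVec_transpose, hsymm, h, smul_dotProduct, smul_eq_mul]
  rw [key y, key (N *ᵥ y), Finset.mul_sum]
  refine Finset.sum_le_sum fun i _ => ?_
  rw [h2]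
  by_cases h0 : hN.eigenvalues i = 0
  · have h := hN.mulVec_eigenvectorBasis i
    rw [h0, zero_smul] at h
    rw [hy _ h]
    simp
  · have := heig _ (hN.eigenvalues_mem_spectrum_real i) h0
    nlinarith [mul_self_nonneg ((hN.eigenvectorBasis i : Fin n → ℝ) ⬝ᵥ y)]

theorem aux_shift {n : ℕ} (M : Matrix (Fin n) (Fin n) ℝ) (hM : Mᵀ = M)
    (h1 : M *ᵥ (fun _ => 1) = 0) (x : Fin n → ℝ) (c : ℝ) :
    (x - c • (fun _ => 1)) ⬝ᵥ (M *ᵥ (x - c • (fun _ => 1))) = x ⬝ᵥ (M *ᵥ x) := by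
  have : (fun _ => 1) ⬝ᵥ (M *ᵥ x) = 0 := by
    rw [dotProduct_mulVec, ← mulVec_transpose, hM, h1, zero_dotProduct]
  rw [mulVec_sub, mulVec_smul, h1, smul_zero, sub_zero, sub_dotProduct, smul_dotProduct, this]
  simp

theorem aux_diag {n : ℕ} (M : Matrix (Fin n) (Fin n) ℝ) (d x y : Fin n → ℝ)
    (h : ∀ v, d v * y v = x v) :
    y ⬝ᵥ ((Matrix.diagonal d * M * Matrix.diagonal d) *ᵥ y) = x ⬝ᵥ (M *ᵥ x) := by
  have hd : Matrix.diagonal d *ᵥ y = x := by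
    ext v
    rw [mulVec_diagonal, h]
  rw [← mulVec_mulVec, hd, ← mulVec_mulVec, dotProduct_mulVec, ← mulVec_transpose,
    diagonal_transpose, hd]

theorem weightedLap_transpose {n : ℕ} (w : Fin n → Fin n → ℝ) (h : ∀ u v, w u v = w v u) :
    (weightedLap w)ᵀ = weightedLap w := by
  ext i j
  by_cases hij : i = j
  · subst hij; rfl
  · simp [weightedLap, hij, Ne.symm hij, h i j]

theorem weightedLap_one {n : ℕ} (w : Fin n → Fin n → ℝ) (h : ∀ v, w v v = 0) :
    weightedLap w *ᵥ (fun _ => 1) = 0 := by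
  ext i
  have : ∀ j, weightedLap w i j = (if i = j then ∑ z, w i z else 0) - w i j := by
    intro j
    by_cases hij : i = j
    · subst hij; simp [weightedLap, h]
    · simp [weightedLap, hij]
  simp [mulVec, dotProduct, this]

/--
Let `L` be the Laplacian of a connected unweighted graph `G`,
`L̃` the Laplacian of a weighted graph `G̃` on the same vertex set, and `D` the
diagonal degree matrix of `G`.  If (1) the second-smallest eigenvalue of
`D^{-1/2} L D^{-1/2}` is at least `λ > 0` (since `G` is connected, `0` is a
simple eigenvalue of the normalized Laplacian, so this says exactly that every
nonzero element of its spectrum is at least `λ`), and (2) the spectral norm of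
`D^{-1/2}(L - L̃)D^{-1/2}` is at most `ε` (for a symmetric matrix, the spectral
norm is at most `ε` iff `|xᵀ M x| ≤ ε ‖x‖²` for all `x`), where `0 ≤ ε < λ`,
then `G̃` is a `σ`-spectral approximation of `G` for `σ = λ/(λ - ε)`.
-/
theorem stmt0 {n : ℕ} (G : SimpleGraph (Fin n)) [DecidableRel G.Adj]
    (hconn : G.Connected)
    (wt : Fin n → Fin n → ℝ)
    (hwtsymm : ∀ u v, wt u v = wt v u) (hwtnonneg : ∀ u v, 0 ≤ wt u v)
    (hwtloop : ∀ v, wt v v = 0)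
    (lam ε : ℝ) (hlam : 0 < lam) (hε0 : 0 ≤ ε) (hεlt : ε < lam)
    -- (1): every nonzero eigenvalue of the normalized Laplacian is at least `lam`
    (heig : ∀ μ ∈ spectrum ℝ
        (Matrix.diagonal (fun v => (Real.sqrt (G.degree v))⁻¹) * G.lapMatrix ℝ *
          Matrix.diagonal fun v => (Real.sqrt (G.degree v))⁻¹),
      μ ≠ 0 → lam ≤ μ)
    -- (2): the spectral norm of `D^{-1/2}(L - L̃)D^{-1/2}` is at most `ε`
    (hnorm : ∀ x : Fin n → ℝ,
      |x ⬝ᵥ ((Matrix.diagonal (fun v => (Real.sqrt (G.degree v))⁻¹) *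
          (G.lapMatrix ℝ - weightedLap wt) *
          Matrix.diagonal fun v => (Real.sqrt (G.degree v))⁻¹) *ᵥ x)| ≤ ε * (x ⬝ᵥ x)) :
    -- conclusion: `G̃` is a `lam/(lam - ε)`-spectral approximation of `G`
    ∀ x : Fin n → ℝ,
      (1 / (lam / (lam - ε))) * (x ⬝ᵥ (weightedLap wt *ᵥ x)) ≤
          x ⬝ᵥ (G.lapMatrix ℝ *ᵥ x) ∧
        x ⬝ᵥ (G.lapMatrix ℝ *ᵥ x) ≤
          (lam / (lam - ε)) * (x ⬝ᵥ (weightedLap wt *ᵥ x)) := by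
  intro x
  have hLt : (G.lapMatrix ℝ)ᵀ = G.lapMatrix ℝ := G.isSymm_lapMatrix (R := ℝ)
  have hL1 : G.lapMatrix ℝ *ᵥ (fun _ => 1) = 0 := G.lapMatrix_mulVec_const_eq_zero (R := ℝ)
  have hWt := weightedLap_transpose wt hwtsymm
  have hW1 := weightedLap_one wt hwtloop
  suffices hmain : lam * |x ⬝ᵥ ((G.lapMatrix ℝ - weightedLap wt) *ᵥ x)| ≤
      ε * (x ⬝ᵥ (G.lapMatrix ℝ *ᵥ x)) by
    rw [sub_mulVec, dotProduct_sub] at hmain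
    set a := x ⬝ᵥ (G.lapMatrix ℝ *ᵥ x)
    set b := x ⬝ᵥ (weightedLap wt *ᵥ x)
    have hd : 0 < lam - ε := by linarith
    have ha : 0 ≤ a := by
      have := (G.posSemidef_lapMatrix ℝ).dotProduct_mulVec_nonneg x
      simpa using this
    have h1 : lam * (a - b) ≤ ε * a :=
      (mul_le_mul_of_nonneg_left (le_abs_self _) hlam.le).trans hmain
    have h2 : lam * (-(a - b)) ≤ ε * a :=
      (mul_le_mul_of_nonneg_left (neg_le_abs _) hlam.le).trans hmain
    constructor
    · rw [one_div_div, div_mul_eq_mul_div, div_le_iff₀ hlam]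
      have h3 : (lam - ε) * (lam * b) ≤ (lam - ε) * ((lam + ε) * a) :=
        mul_le_mul_of_nonneg_left (by linarith) hd.le
      have h4 : lam * ((lam - ε) * b) ≤ lam * (a * lam) := by
        nlinarith [mul_nonneg (mul_self_nonneg ε) ha]
      exact le_of_mul_le_mul_left h4 hlam
    · rw [div_mul_eq_mul_div, le_div_iff₀ hd]
      linarith
  rcases subsingleton_or_nontrivial (Fin n) with hs | hs
  · have hx : ∀ M : Matrix (Fin n) (Fin n) ℝ, M *ᵥ (fun _ => 1) = 0 → M *ᵥ x = 0 := by
      intro M hM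
      have : ∀ i : Fin n, x = x i • (fun _ => 1) := by
        intro i
        ext j
        simp [Subsingleton.elim j i]
      ext i
      rw [this i, mulVec_smul, hM, smul_zero]
    rw [sub_mulVec, hx _ hL1, hx _ hW1]
    simp
  have hdeg : ∀ v, 0 < G.degree v := fun v => hconn.preconnected.degree_pos_of_nontrivial v
  have hdegR : ∀ v, (0 : ℝ) < G.degree v := fun v => by exact_mod_cast hdeg v
  have hs0 : ∀ v, 0 < Real.sqrt (G.degree v) := fun v => Real.sqrt_pos.2 (hdegR v)
  have hS : 0 < ∑ v, (G.degree v : ℝ) :=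
    Finset.sum_pos (fun v _ => hdegR v) Finset.univ_nonempty
  obtain ⟨c, hc⟩ : ∃ c : ℝ, ∑ v, (G.degree v : ℝ) * (x v - c) = 0 := by
    refine ⟨(∑ v, (G.degree v : ℝ) * x v) / ∑ v, (G.degree v : ℝ), ?_⟩
    simp only [mul_sub, Finset.sum_sub_distrib, ← Finset.sum_mul]
    field_simp
    ring
  rw [← aux_shift _ (by rw [transpose_sub, hLt, hWt]) (by rw [sub_mulVec, hL1, hW1, sub_zero]) x c,
    ← aux_shift _ hLt hL1 x c]
  set x' : Fin n → ℝ := x - c • (fun _ => 1) with hx'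
  set y : Fin n → ℝ := fun v => Real.sqrt (G.degree v) * x' v with hy
  have hdy : ∀ v, (Real.sqrt (G.degree v))⁻¹ * y v = x' v := fun v => by
    simp only [hy]
    rw [inv_mul_cancel_left₀ (hs0 v).ne']
  have hn := hnorm y
  rw [aux_diag _ _ x' y hdy] at hn
  have hg := aux_gap _ (by
    rw [Matrix.IsHermitian, conjTranspose_eq_transpose_of_trivial, transpose_mul, transpose_mul,
      diagonal_transpose, hLt, Matrix.mul_assoc]) lam heig y (by
    intro v hv
    rw [← mulVec_mulVec, ← mulVec_mulVec] at hv
    have hz : G.lapMatrix ℝ *ᵥ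
        ((Matrix.diagonal fun v => (Real.sqrt (G.degree v))⁻¹) *ᵥ v) = 0 := by
      ext i
      have := congrFun hv i
      rw [mulVec_diagonal] at this
      exact (mul_eq_zero.1 this).resolve_left (inv_ne_zero (hs0 i).ne')
    rw [SimpleGraph.lapMatrix_mulVec_eq_zero_iff_forall_reachable] at hz
    obtain ⟨i0⟩ := hconn.nonempty
    have hz' : ∀ i, v i = Real.sqrt (G.degree i) * ((Real.sqrt (G.degree i0))⁻¹ * v i0) := by
      intro i
      have := hz i i0 (hconn.preconnected i i0)
      rw [mulVec_diagonal, mulVec_diagonal] at this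
      rw [← this, mul_inv_cancel_left₀ (hs0 i).ne']
    have : v ⬝ᵥ y = ((Real.sqrt (G.degree i0))⁻¹ * v i0) *
        ∑ v, (G.degree v : ℝ) * (x v - c) := by
      rw [dotProduct, Finset.mul_sum]
      refine Finset.sum_congr rfl fun i _ => ?_
      rw [hz' i]
      have h5 := Real.mul_self_sqrt (hdegR i).le
      have h6 : y i = Real.sqrt (G.degree i) * (x i - c) := by simp [hy, hx']
      rw [h6]
      linear_combination ((Real.sqrt (G.degree i0))⁻¹ * v i0) * (x i - c) * h5
    rw [this, hc, mul_zero])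
  rw [aux_diag _ _ x' y hdy] at hg
  calc _ ≤ lam * (ε * (y ⬝ᵥ y)) := mul_le_mul_of_nonneg_left hn hlam.le
    _ = ε * (lam * (y ⬝ᵥ y)) := by ring
    _ ≤ _ := mul_le_mul_of_nonneg_left hg hε0
end

section
/- Let G = (V,E) be an unweighted graph with positive degrees d_v, fix Υ > 1, and for each edge set p_{i,j} = min(1, Υ/min(d_i, d_j)). For a fixed edge (r,t), let X be a random variable taking value 1/p_{r,t} with probability p_{r,t} and 0 with probability 1 − p_{r,t}, and set Δ_{r,t} = (X − 1)/d_r and Δ_{t,r} = (X − 1)/d_t. Then for all integers k ≥ 1 and l ≥ 0, E[Δ_{r,t}^k · Δ_{t,r}^l] ≤ 1/(Υ^{k+l−1}·d_r). -/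
theorem bracket_le (q : ℝ) (h0 : 0 < q) (h1 : q ≤ 1) (j : ℕ) :
    q * (1 / q - 1) ^ (j + 1) + (1 - q) * (0 - 1) ^ (j + 1) ≤ (1 / q) ^ j := by
  have hx : 0 ≤ 1 / q - 1 := by
    have := one_le_one_div h0 h1
    linarith
  have hqx : q * (1 / q - 1) = 1 - q := by field_simp
  have e : q * (1 / q - 1) ^ (j + 1) + (1 - q) * (0 - 1) ^ (j + 1)
      = (1 - q) * ((1 / q - 1) ^ j + (0 - 1) ^ (j + 1)) := by
    rw [pow_succ (1 / q - 1), mul_comm ((1 / q - 1) ^ j), ← mul_assoc, hqx]; ring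
  rw [e]
  rcases Nat.eq_zero_or_pos j with rfl | hj
  · simp
  · have h2 : (1 / q - 1) ^ j + 1 ^ j ≤ ((1 / q - 1) + 1) ^ j :=
      pow_add_pow_le hx zero_le_one hj.ne'
    rw [sub_add_cancel, one_pow] at h2
    have h3 : ((0 : ℝ) - 1) ^ (j + 1) ≤ 1 := by
      rw [zero_sub]
      rcases neg_one_pow_eq_or ℝ (j + 1) with h | h <;> rw [h] <;> norm_num
    have h4 : 0 ≤ (1 / q - 1) ^ j := pow_nonneg hx j
    calc _ ≤ (1 - q) * ((1 / q - 1) ^ j + 1) := by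
            apply mul_le_mul_of_nonneg_left _ (by linarith)
            exact add_le_add le_rfl h3
      _ ≤ 1 * ((1 / q - 1) ^ j + 1) := by
            apply mul_le_mul_of_nonneg_right <;> linarith
      _ ≤ _ := by linarith

theorem edge_aux (a b m Υ q : ℝ) (hm : 0 < m) (hma : m ≤ a) (hmb : m ≤ b) (hΥ : 1 < Υ)
    (hq : q = min 1 (Υ / m)) (i l : ℕ) :
    q * (((1 / q - 1) / a) ^ (i + 1) * ((1 / q - 1) / b) ^ l) +
        (1 - q) * (((0 - 1) / a) ^ (i + 1) * ((0 - 1) / b) ^ l) ≤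
      1 / (Υ ^ (i + l) * a) := by
  have ha : 0 < a := hm.trans_le hma
  have hb : 0 < b := hm.trans_le hmb
  have hU : 0 < Υ := by linarith
  rcases le_total 1 (Υ / m) with h | h
  · rw [min_eq_left h] at hq
    subst hq
    simp
    positivity
  · rw [min_eq_right h] at hq
    have h0 : 0 < q := by rw [hq]; positivity
    have hB := bracket_le q h0 (hq ▸ h) (i + l)
    have hD : a * m ^ (i + l) ≤ a ^ (i + 1) * b ^ l := by
      rw [pow_add, pow_succ, mul_comm (a ^ i) a, mul_assoc]
      gcongr
    have hqm : 1 / q = m / Υ := by rw [hq, one_div_div]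
    calc _ = (q * (1 / q - 1) ^ (i + l + 1) + (1 - q) * (0 - 1) ^ (i + l + 1))
            / (a ^ (i + 1) * b ^ l) := by
            generalize 1 / q - 1 = x
            generalize (0 : ℝ) - 1 = y
            simp only [div_pow]
            field_simp
            ring
      _ ≤ (1 / q) ^ (i + l) / (a ^ (i + 1) * b ^ l) := by gcongr
      _ ≤ (1 / q) ^ (i + l) / (a * m ^ (i + l)) := by gcongr
      _ = _ := by
            rw [hqm, div_pow]
            field_simp

/--
**Lemma on edge expectations.**
Fix an edge `(r,t)` of an unweighted graph `G` with positive degrees, `Υ > 1`,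
and let `q = p_{r,t} = min(1, Υ/min(d_r,d_t))`.  Let `X` take the value `1/q`
with probability `q` and `0` with probability `1 − q`, and set
`Δ_{r,t} = (X−1)/d_r`, `Δ_{t,r} = (X−1)/d_t`.  Then for all integers `k ≥ 1`
and `l ≥ 0`,
`E[Δ_{r,t}^k Δ_{t,r}^l] ≤ 1/(Υ^{k+l−1} d_r)`.
The expectation is written out explicitly as the two-point weighted sum.
-/
theorem stmt5 {n : ℕ} (G : SimpleGraph (Fin n)) [DecidableRel G.Adj]
    (hdeg : ∀ v, 0 < G.degree v) (Υ : ℝ) (hΥ : 1 < Υ)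
    (r t : Fin n) (hrt : G.Adj r t)
    (q : ℝ) (hq : q = min 1 (Υ / (min (G.degree r) (G.degree t) : ℕ)))
    (k l : ℕ) (hk : 1 ≤ k) :
    q * (((1 / q - 1) / (G.degree r : ℝ)) ^ k * ((1 / q - 1) / (G.degree t : ℝ)) ^ l) +
        (1 - q) * (((0 - 1) / (G.degree r : ℝ)) ^ k * ((0 - 1) / (G.degree t : ℝ)) ^ l) ≤
      1 / (Υ ^ (k + l - 1) * (G.degree r : ℝ)) := by
  obtain ⟨i, rfl⟩ : ∃ i, k = i + 1 := ⟨k - 1, by omega⟩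
  have e : i + 1 + l - 1 = i + l := by omega
  rw [e]
  exact edge_aux _ _ _ Υ q (by exact_mod_cast lt_min (hdeg r) (hdeg t))
    (by exact_mod_cast min_le_left _ _) (by exact_mod_cast min_le_right _ _) hΥ hq i l
end

section
/- Let G = (V,E) be an unweighted graph with m ≥ 1 edges. Then there exists a partition (A₁, …, A_k) of V such that Φ^{A_i} ≥ (6·log_{4/3}(2m))^{-1} for every i, and the number of edges of E with endpoints in two different parts of the partition is at most m/2. -/
/-- The volume of a set of vertices: the sum of the degrees (in `G`) of its
vertices. -/
def gvol {n : ℕ} (G : SimpleGraph (Fin n)) [DecidableRel G.Adj]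
    (S : Finset (Fin n)) : ℕ :=
  ∑ v ∈ S, G.degree v

/-- `|E(S,T)|`: the number of edges of `G` with one endpoint in `S` and the
other in `T` (for disjoint `S`, `T` each such edge is counted exactly once as
an ordered pair). -/
def ecut {n : ℕ} (G : SimpleGraph (Fin n)) [DecidableRel G.Adj]
    (S T : Finset (Fin n)) : ℕ :=
  ((S ×ˢ T).filter fun e => G.Adj e.1 e.2).card

noncomputable def ent (x : ℝ) : ℝ := x * Real.logb 2 x

lemma ent_zero : ent 0 = 0 := by simp [ent]

lemma ent_nat_nonneg (a : ℕ) : 0 ≤ ent (a : ℝ) := by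
  unfold ent
  rcases Nat.eq_zero_or_pos a with h | h
  · simp [h]
  · apply mul_nonneg (by positivity)
    exact Real.logb_nonneg (by norm_num) (by exact_mod_cast h)

lemma ent_split_aux (a b : ℝ) (ha : 0 ≤ a) (hab : a ≤ b) :
    ent a + ent b + a ≤ ent (a + b) := by
  rcases ha.eq_or_lt with h | h
  · subst h; simp [ent]
  · have hb : 0 < b := lt_of_lt_of_le h hab
    have h1 : Real.logb 2 (2 * a) ≤ Real.logb 2 (a + b) :=
      Real.logb_le_logb_of_le (by norm_num) (by positivity) (by linarith)
    have h2 : Real.logb 2 b ≤ Real.logb 2 (a + b) :=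
      Real.logb_le_logb_of_le (by norm_num) (by positivity) (by linarith)
    rw [Real.logb_mul (by norm_num) h.ne', Real.logb_self_eq_one (by norm_num)] at h1
    unfold ent
    nlinarith [mul_le_mul_of_nonneg_left h1 h.le, mul_le_mul_of_nonneg_left h2 hb.le]

lemma ent_split (a b : ℝ) (ha : 0 ≤ a) (hb : 0 ≤ b) :
    ent a + ent b + min a b ≤ ent (a + b) := by
  rcases le_total a b with h | h
  · rw [min_eq_left h]; exact ent_split_aux a b ha h
  · rw [min_eq_right h, add_comm a b, add_comm (ent a)]; exact ent_split_aux b a hb h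

def cpart {n : ℕ} (c : Fin n → Fin (n+1)) (i : Fin (n+1)) : Finset (Fin n) :=
  Finset.univ.filter fun v => c v = i

def ccut {n : ℕ} (G : SimpleGraph (Fin n)) [DecidableRel G.Adj] (c : Fin n → Fin (n+1)) :
    Finset (Fin n × Fin n) :=
  Finset.univ.filter fun e => e.1 < e.2 ∧ G.Adj e.1 e.2 ∧ c e.1 ≠ c e.2

lemma exists_free {n : ℕ} (c : Fin n → Fin (n+1)) : ∃ j, ∀ v, c v ≠ j := by
  by_contra h
  push Not at h
  have := Fintype.card_le_of_surjective c h
  simp at this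

lemma ccut_split {n : ℕ} (G : SimpleGraph (Fin n)) [DecidableRel G.Adj]
    (c : Fin n → Fin (n+1)) (i j : Fin (n+1)) (S : Finset (Fin n)) (hS : S ⊆ cpart c i) :
    (ccut G (fun v => if v ∈ S then j else c v)).card ≤
      (ccut G c).card + ecut G S (cpart c i \ S) := by
  have hsub : ccut G (fun v => if v ∈ S then j else c v) ⊆ ccut G c ∪
      (((S ×ˢ (cpart c i \ S)).filter fun e => G.Adj e.1 e.2).image
        fun e => (min e.1 e.2, max e.1 e.2)) := by
    rintro ⟨x, y⟩ h
    simp only [ccut, Finset.mem_filter, Finset.mem_univ, true_and] at h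
    obtain ⟨hlt, hadj, hne⟩ := h
    rw [Finset.mem_union]
    by_cases hc : c x = c y
    · right
      rw [Finset.mem_image]
      have hS' : ∀ v ∈ S, c v = i := fun v hv => by simpa [cpart] using hS hv
      by_cases hx : x ∈ S <;> by_cases hy : y ∈ S
      · simp [hx, hy] at hne
      · refine ⟨(x, y), ?_, by simp [hlt.le]⟩
        simp [hx, hy, hadj, cpart, ← hc, hS' x hx]
      · refine ⟨(y, x), ?_, by simp [hlt.le]⟩
        simp [hx, hy, hadj.symm, cpart, hc, hS' y hy]
      · simp [hx, hy, hc] at hne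
    · left
      simp [ccut, hlt, hadj, hc]
  calc _ ≤ _ := Finset.card_le_card hsub
    _ ≤ _ := Finset.card_union_le _ _
    _ ≤ _ := Nat.add_le_add_left Finset.card_image_le _

lemma ent_sum_split {n : ℕ} (G : SimpleGraph (Fin n)) [DecidableRel G.Adj]
    (c : Fin n → Fin (n+1)) (i j : Fin (n+1)) (hij : i ≠ j) (hj : ∀ v, c v ≠ j)
    (S : Finset (Fin n)) (hS : S ⊆ cpart c i) :
    ∑ l, ent (gvol G (cpart (fun v => if v ∈ S then j else c v) l)) +
      min (gvol G S : ℝ) (gvol G (cpart c i \ S) : ℝ) ≤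
    ∑ l, ent (gvol G (cpart c l)) := by
  have hS' : ∀ v ∈ S, c v = i := fun v hv => by simpa [cpart] using hS hv
  have hi : cpart (fun v => if v ∈ S then j else c v) i = cpart c i \ S := by
    ext v
    by_cases hv : v ∈ S <;> simp [cpart, hv, hij.symm]
  have hjj : cpart (fun v => if v ∈ S then j else c v) j = S := by
    ext v
    by_cases hv : v ∈ S <;> simp [cpart, hv, hj]
  have hj0 : cpart c j = ∅ := by
    ext v; simp [cpart, hj]
  have ho : ∀ l, l ≠ i → l ≠ j →
      cpart (fun v => if v ∈ S then j else c v) l = cpart c l := by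
    intro l h1 h2
    ext v
    by_cases hv : v ∈ S <;> simp [cpart, hv, h2.symm, hS', h1.symm]
  have hmem : j ∈ Finset.univ.erase i := by simp [hij.symm]
  rw [← Finset.add_sum_erase _ _ (Finset.mem_univ i), ← Finset.add_sum_erase _ _ hmem,
    ← Finset.add_sum_erase Finset.univ (fun l => ent (gvol G (cpart c l))) (Finset.mem_univ i),
    ← Finset.add_sum_erase _ (fun l => ent (gvol G (cpart c l))) hmem]
  have hrest : ∑ l ∈ (Finset.univ.erase i).erase j,
      ent (gvol G (cpart (fun v => if v ∈ S then j else c v) l)) =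
      ∑ l ∈ (Finset.univ.erase i).erase j, ent (gvol G (cpart c l)) := by
    apply Finset.sum_congr rfl
    intro l hl
    simp only [Finset.mem_erase] at hl
    rw [ho l hl.2.1 hl.1]
  rw [hrest, hi, hjj, hj0]
  have hv : (gvol G (cpart c i) : ℝ) = gvol G S + gvol G (cpart c i \ S) := by
    have : gvol G (cpart c i \ S) + gvol G S = gvol G (cpart c i) := Finset.sum_sdiff hS
    rw [← this]; push_cast; ring
  have h0 : ent ((gvol G ∅ : ℕ) : ℝ) = 0 := by simp [gvol, ent_zero]
  have := ent_split (gvol G S) (gvol G (cpart c i \ S)) (by positivity) (by positivity)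
  rw [hv, h0]
  linarith

/--
**Theorem: graph decompositions exist.**
Every unweighted graph `G` with `m ≥ 1` edges has a partition `(A₁,…,A_k)` of
its vertex set such that `Φ^{A_i} ≥ (6 log_{4/3}(2m))⁻¹` for every `i`, and at
most `m/2` edges have endpoints in two different parts.  The conductance lower
bound `Φ^{A_i}(S) ≥ c` is written in the denominator-cleared form
`c · min(vol S, vol(A_i \ S)) ≤ |E(S, A_i \ S)|` for every `S ⊂ A_i`
(for `S = ∅` or `|A_i| = 1` this is trivially true, matching the conventions
`Φ^{A_i}(∅) = 1` and `Φ^{A_i} = 1` for singletons, since the constant is `≤ 1`).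
-/
theorem stmt7 {n : ℕ} (G : SimpleGraph (Fin n)) [DecidableRel G.Adj]
    (m : ℕ) (hm : m = G.edgeFinset.card) (hm1 : 1 ≤ m) :
    ∃ (k : ℕ) (A : Fin k → Finset (Fin n)),
      (∀ v : Fin n, ∃! i, v ∈ A i) ∧
      (∀ i, ∀ S ⊂ A i,
        (6 * Real.logb (4 / 3) (2 * m))⁻¹ *
            min (gvol G S : ℝ) (gvol G (A i \ S) : ℝ) ≤
          (ecut G S (A i \ S) : ℝ)) ∧
      (((Finset.univ.filter fun e : Fin n × Fin n =>
          e.1 < e.2 ∧ G.Adj e.1 e.2 ∧ ∀ i, ¬ (e.1 ∈ A i ∧ e.2 ∈ A i)).card : ℝ) ≤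
        (m : ℝ) / 2) := by
  have hL : 0 < Real.logb (4 / 3) (2 * m) := by
    apply Real.logb_pos (by norm_num)
    have : (1 : ℝ) ≤ m := by exact_mod_cast hm1
    linarith
  set K : ℝ := (6 * Real.logb (4 / 3) (2 * m))⁻¹ with hK
  have hK0 : 0 < K := by positivity
  obtain ⟨c, -, hc⟩ := Finset.exists_min_image (Finset.univ : Finset (Fin n → Fin (n+1)))
    (fun c => ((ccut G c).card : ℝ) + K * ∑ l, ent (gvol G (cpart c l))) Finset.univ_nonempty
  refine ⟨n + 1, cpart c, ?_, ?_, ?_⟩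
  · intro v
    exact ⟨c v, by simp [cpart], fun i hi => by simpa [cpart, eq_comm] using hi⟩
  · intro i S hS
    by_contra hlt
    push Not at hlt
    obtain ⟨j, hj⟩ := exists_free c
    have hij : i ≠ j := by
      rintro rfl
      obtain ⟨v, hv, -⟩ := Finset.exists_of_ssubset hS
      exact hj v (by simpa [cpart] using hv)
    have h1 := hc (fun v => if v ∈ S then j else c v) (Finset.mem_univ _)
    have h2 : ((ccut G (fun v => if v ∈ S then j else c v)).card : ℝ) ≤
      (ccut G c).card + ecut G S (cpart c i \ S) := by
      exact_mod_cast ccut_split G c i j S hS.1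
    have h3 := mul_le_mul_of_nonneg_left (ent_sum_split G c i j hij hj S hS.1) hK0.le
    rw [mul_add] at h3
    linarith
  · have h1 := hc (fun _ => 0) (Finset.mem_univ _)
    have hcut : (Finset.univ.filter fun e : Fin n × Fin n =>
          e.1 < e.2 ∧ G.Adj e.1 e.2 ∧ ∀ i, ¬ (e.1 ∈ cpart c i ∧ e.2 ∈ cpart c i)) = ccut G c := by
      ext e
      simp [ccut, cpart, eq_comm]
    rw [hcut]
    have h2 : 0 ≤ K * ∑ l, ent (gvol G (cpart c l)) :=
      mul_nonneg hK0.le (Finset.sum_nonneg fun l _ => ent_nat_nonneg _)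
    have h3 : ccut G (fun _ => 0) = ∅ := by simp [ccut]
    have h4 : ∑ l, ent (gvol G (cpart (fun _ : Fin n => 0) l)) = ent (2 * m) := by
      rw [Finset.sum_eq_single 0]
      · have : gvol G (cpart (fun _ : Fin n => 0) 0) = 2 * m := by
          rw [hm, ← G.sum_degrees_eq_twice_card_edges]
          simp [gvol, cpart]
        rw [this]; push_cast; rfl
      · intro l _ hl
        have : cpart (fun _ : Fin n => 0) l = ∅ := by
          ext v; simp [cpart, hl.symm]
        rw [this]; simp [gvol, ent_zero]
      · simp
    have h5 : K * ent (2 * m) ≤ m / 2 := by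
      have hm' : (1 : ℝ) ≤ m := by exact_mod_cast hm1
      have hlog : 0 < Real.log (2 * m) := Real.log_pos (by linarith)
      have hl2 : 0 < Real.log 2 := Real.log_pos (by norm_num)
      have hl3 : 0 < Real.log (4 / 3) := Real.log_pos (by norm_num)
      have hle : Real.log (4 / 3) ≤ Real.log 2 := Real.log_le_log (by norm_num) (by norm_num)
      have hle2 : Real.logb 2 (2 * m) ≤ Real.logb (4 / 3) (2 * m) := by
        unfold Real.logb
        exact div_le_div_of_nonneg_left hlog.le hl3 hle
      rw [hK, inv_mul_le_iff₀ (by positivity)]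
      unfold ent
      nlinarith [mul_le_mul_of_nonneg_left hle2 (by linarith : (0 : ℝ) ≤ m),
        mul_pos (by linarith : (0 : ℝ) < m) hL]
    simp only [h3, h4, Finset.card_empty, Nat.cast_zero, zero_add] at h1
    linarith
end

section
/- Let G = (V,E) be an unweighted graph, let 0 < φ ≤ 1, and let B ⊆ V. Let S ⊂ B be a set maximizing vol(S) among all subsets S' ⊂ B satisfying (C.1) vol(S') ≤ vol(B)/2 and (C.2) Φ^B(S') ≤ φ; that is, S satisfies (C.1) and (C.2) and every S' ⊂ B satisfying (C.1) and (C.2) has vol(S') ≤ vol(S). If vol(S) = α·vol(B) with α ≤ 1/3, then Φ^{B−S} ≥ φ·(1 − 3α)/(1 − α). -/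
theorem ecut_comm' {n : ℕ} (G : SimpleGraph (Fin n)) [DecidableRel G.Adj]
    (S T : Finset (Fin n)) : ecut G S T = ecut G T S := by
  unfold ecut
  refine Finset.card_bij (fun e _ => (e.2, e.1)) ?_ ?_ ?_
  · intro e he
    simp only [Finset.mem_filter, Finset.mem_product] at he ⊢
    exact ⟨⟨he.1.2, he.1.1⟩, he.2.symm⟩
  · rintro ⟨a, b⟩ _ ⟨c, d⟩ _ h
    simp only [Prod.mk.injEq] at h ⊢
    exact ⟨h.2, h.1⟩
  · rintro ⟨a, b⟩ he
    simp only [Finset.mem_filter, Finset.mem_product] at he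
    exact ⟨(b, a), by
      simp only [Finset.mem_filter, Finset.mem_product]
      exact ⟨⟨he.1.2, he.1.1⟩, he.2.symm⟩, rfl⟩

theorem ecut_union_le {n : ℕ} (G : SimpleGraph (Fin n)) [DecidableRel G.Adj]
    (S R T : Finset (Fin n)) : ecut G (S ∪ R) T ≤ ecut G S T + ecut G R T := by
  unfold ecut
  rw [Finset.union_product, Finset.filter_union]
  exact Finset.card_union_le _ _

theorem ecut_mono_right {n : ℕ} (G : SimpleGraph (Fin n)) [DecidableRel G.Adj]
    (S : Finset (Fin n)) {T U : Finset (Fin n)} (h : T ⊆ U) : ecut G S T ≤ ecut G S U := by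
  unfold ecut
  exact Finset.card_le_card (Finset.filter_subset_filter _ (Finset.product_subset_product_right h))

theorem gvol_union {n : ℕ} (G : SimpleGraph (Fin n)) [DecidableRel G.Adj]
    {S T : Finset (Fin n)} (h : Disjoint S T) : gvol G (S ∪ T) = gvol G S + gvol G T := by
  unfold gvol
  exact Finset.sum_union h

theorem stmt8_aux {n : ℕ} (G : SimpleGraph (Fin n)) [DecidableRel G.Adj]
    (φ : ℝ) (hφ0 : 0 < φ)
    (B S : Finset (Fin n)) (hSB : S ⊆ B)
    (hC2 : (ecut G S (B \ S) : ℝ) ≤ φ * min (gvol G S : ℝ) (gvol G (B \ S) : ℝ))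
    (hmax : ∀ S' ⊂ B, 2 * gvol G S' ≤ gvol G B →
      (ecut G S' (B \ S') : ℝ) ≤ φ * min (gvol G S' : ℝ) (gvol G (B \ S') : ℝ) →
      gvol G S' ≤ gvol G S)
    (α : ℝ) (hα : (gvol G S : ℝ) = α * (gvol G B : ℝ)) (hα3 : α ≤ 1 / 3)
    (R T : Finset (Fin n)) (hd : Disjoint R T) (hRT : R ∪ T = B \ S)
    (hle : gvol G R ≤ gvol G T) :
    φ * ((1 - 3 * α) / (1 - α)) * (gvol G R : ℝ) ≤ (ecut G R T : ℝ) := by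
  have hmem : ∀ x, (x ∈ R ∨ x ∈ T) ↔ (x ∈ B ∧ x ∉ S) := by
    intro x
    rw [← Finset.mem_union, hRT, Finset.mem_sdiff]
  have hd' : ∀ x, x ∈ R → x ∉ T := fun x h => Finset.disjoint_left.1 hd h
  have e1 : B \ (S ∪ R) = T := by
    ext x
    have := hmem x
    have := hd' x
    simp only [Finset.mem_sdiff, Finset.mem_union]
    tauto
  have e2 : B \ T = S ∪ R := by
    ext x
    have := hmem x
    have := hd' x
    have := @hSB x
    simp only [Finset.mem_sdiff, Finset.mem_union]
    tauto
  have dSR : Disjoint S R := Finset.disjoint_left.2 fun x hx hr => ((hmem x).1 (Or.inl hr)).2 hx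
  have hB : gvol G B = gvol G S + (gvol G R + gvol G T) := by
    rw [← gvol_union G hd, hRT, ← gvol_union G Finset.disjoint_sdiff,
      Finset.union_sdiff_of_subset hSB]
  have hSR := gvol_union G dSR
  have hTB : T ⊆ B := fun x hx => ((hmem x).1 (Or.inr hx)).1
  have hRB : R ⊆ B := fun x hx => ((hmem x).1 (Or.inl hx)).1
  by_contra! hlt
  have hr0 : 0 < gvol G R := by
    rcases Nat.eq_zero_or_pos (gvol G R) with h | h
    · rw [h] at hlt
      have : (0 : ℝ) ≤ ecut G R T := Nat.cast_nonneg _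
      simp at hlt
      linarith
    · exact h
  have hcut : (ecut G (S ∪ R) T : ℝ) ≤ ecut G S (B \ S) + ecut G R T := by
    have h1 := ecut_union_le G S R T
    have h2 := ecut_mono_right G S (T := T) (U := B \ S) (by
      rw [← hRT]; exact Finset.subset_union_right)
    exact_mod_cast h1.trans (Nat.add_le_add_right h2 _)
  have hS : (ecut G S (B \ S) : ℝ) ≤ φ * gvol G S :=
    hC2.trans (mul_le_mul_of_nonneg_left (min_le_left _ _) hφ0.le)
  have hSR' : (gvol G (S ∪ R) : ℝ) = gvol G S + gvol G R := by exact_mod_cast hSR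
  have hBr : (gvol G B : ℝ) = gvol G S + (gvol G R + gvol G T) := by exact_mod_cast hB
  have hler : (gvol G R : ℝ) ≤ gvol G T := by exact_mod_cast hle
  have hr0r : (0 : ℝ) < gvol G R := by exact_mod_cast hr0
  have hs0 : (0 : ℝ) ≤ gvol G S := Nat.cast_nonneg _
  have he0 : (0 : ℝ) ≤ ecut G R T := Nat.cast_nonneg _
  have hb0 : (0 : ℝ) < gvol G B := by linarith
  have hα0 : 0 ≤ α := by
    by_contra! h
    nlinarith
  have h1α : 0 < 1 - α := by linarith
  obtain ⟨c, hc⟩ : ∃ c, c = (1 - 3 * α) / (1 - α) := ⟨_, rfl⟩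
  rw [← hc] at hlt
  have hcm : c * (1 - α) = 1 - 3 * α := by rw [hc]; field_simp
  have hc1 : c ≤ 1 := by rw [hc, div_le_one h1α]; linarith
  have hc0 : 0 < c := by
    by_contra! h
    have : φ * c * (gvol G R : ℝ) ≤ 0 :=
      mul_nonpos_of_nonpos_of_nonneg (mul_nonpos_of_nonneg_of_nonpos hφ0.le h) hr0r.le
    linarith
  have hα3' : 0 < 1 - 3 * α := by rw [← hcm]; positivity
  by_cases hcase : 2 * gvol G (S ∪ R) ≤ gvol G B
  · have hcaser : 2 * (gvol G (S ∪ R) : ℝ) ≤ gvol G B := by exact_mod_cast hcase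
    have hss : S ∪ R ⊂ B := by
      refine lt_of_le_of_ne (Finset.union_subset hSB hRB) ?_
      intro h
      rw [h] at hcase
      have : gvol G B = 0 := by omega
      omega
    have := hmax _ hss hcase (by
      rw [e1, min_eq_left (by linarith), hSR']
      have : φ * c * (gvol G R : ℝ) ≤ φ * gvol G R := by
        have := mul_le_mul_of_nonneg_left hc1 (mul_pos hφ0 hr0r).le
        linarith
      linarith)
    omega
  · have hT2 : 2 * gvol G T ≤ gvol G B := by omega
    have hT2r : 2 * (gvol G T : ℝ) ≤ gvol G B := by exact_mod_cast hT2
    have hss : T ⊂ B := by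
      refine lt_of_le_of_ne hTB ?_
      intro h
      rw [h] at hB
      omega
    have hsum : (gvol G R : ℝ) + gvol G T = (1 - α) * gvol G B := by linarith
    have hcr : c * gvol G R ≤ (1 - 3 * α) * gvol G B / 2 := by
      have : c * gvol G R ≤ c * ((1 - α) * gvol G B / 2) :=
        mul_le_mul_of_nonneg_left (by linarith) hc0.le
      rw [← hcm]; linarith
    have hkey : (gvol G S : ℝ) + c * gvol G R ≤ gvol G T := by linarith
    have := hmax _ hss hT2 (by
      rw [e2, ecut_comm', min_eq_left (by linarith)]
      have := mul_le_mul_of_nonneg_left hkey hφ0.le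
      linarith)
    have h3 : (gvol G T : ℝ) ≤ gvol G S := by exact_mod_cast this
    have := mul_pos hc0 hr0r
    linarith

/--
**Lemma: sparsest cuts as certificates.**
Let `0 < φ ≤ 1`, `B ⊆ V`, and let `S ⊂ B` maximize `vol(S)` among sets
satisfying (C.1) `vol(S) ≤ vol(B)/2` and (C.2) `Φ^B(S) ≤ φ`.  If
`vol(S) = α·vol(B)` with `α ≤ 1/3`, then `Φ^{B−S} ≥ φ(1−3α)/(1−α)`.
Conductance inequalities are written in their denominator-cleared form:
`Φ^B(S) ≤ φ` becomes `|E(S, B\S)| ≤ φ · min(vol S, vol(B\S))`, and the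
conclusion `Φ^{B−S}(R) ≥ c` becomes
`c · min(vol R, vol((B\S)\R)) ≤ |E(R, (B\S)\R)|` for every `R ⊂ B \ S`
(these are equivalent whenever the denominators are nonzero, and the
conventions `Φ(∅) = 1`, `Φ^{B'} = 1` for `|B'| = 1` are respected since
`φ ≤ 1`).
-/
theorem stmt8 {n : ℕ} (G : SimpleGraph (Fin n)) [DecidableRel G.Adj]
    (φ : ℝ) (hφ0 : 0 < φ) (hφ1 : φ ≤ 1)
    (B S : Finset (Fin n)) (hSB : S ⊂ B)
    (hC1 : 2 * gvol G S ≤ gvol G B)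
    (hC2 : (ecut G S (B \ S) : ℝ) ≤ φ * min (gvol G S : ℝ) (gvol G (B \ S) : ℝ))
    (hmax : ∀ S' ⊂ B, 2 * gvol G S' ≤ gvol G B →
      (ecut G S' (B \ S') : ℝ) ≤ φ * min (gvol G S' : ℝ) (gvol G (B \ S') : ℝ) →
      gvol G S' ≤ gvol G S)
    (α : ℝ) (hα : (gvol G S : ℝ) = α * (gvol G B : ℝ)) (hα3 : α ≤ 1 / 3) :
    ∀ R ⊂ B \ S,
      φ * ((1 - 3 * α) / (1 - α)) *
          min (gvol G R : ℝ) (gvol G ((B \ S) \ R) : ℝ) ≤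
        (ecut G R ((B \ S) \ R) : ℝ) := by
  intro R hR
  have hu : R ∪ ((B \ S) \ R) = B \ S := Finset.union_sdiff_of_subset hR.1
  have hd : Disjoint R ((B \ S) \ R) := Finset.disjoint_sdiff
  rcases le_total (gvol G R) (gvol G ((B \ S) \ R)) with h | h
  · rw [min_eq_left (by exact_mod_cast h)]
    exact stmt8_aux G φ hφ0 B S hSB.1 hC2 hmax α hα hα3 _ _ hd hu h
  · rw [min_eq_right (by exact_mod_cast h), ecut_comm']
    exact stmt8_aux G φ hφ0 B S hSB.1 hC2 hmax α hα hα3 _ _ hd.symm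
      (by rw [Finset.union_comm]; exact hu) h
end

section
/- Let A and B be symmetric positive semidefinite real matrices of the same size and let 0 < β < 1/2 and 0 < γ < 1/2. If for all vectors x, (1/(1+γ))·x^T(A + βB)x ≤ (1+β)·x^T B x ≤ (1+γ)·x^T(A + βB)x, then for all vectors x, (1/((1+β)(1+γ)))·x^T A x ≤ x^T B x ≤ (1+β)(1+γ)·x^T A x. -/
open Matrix

/--
Let `A` and `B` be symmetric positive semidefinite real
matrices and `0 < β < 1/2`, `0 < γ < 1/2`.  If for all vectors `x`,
`(1/(1+γ))·xᵀ(A + βB)x ≤ (1+β)·xᵀBx ≤ (1+γ)·xᵀ(A + βB)x`,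
then for all `x`,
`(1/((1+β)(1+γ)))·xᵀAx ≤ xᵀBx ≤ (1+β)(1+γ)·xᵀAx`.
-/
theorem stmt11 {n : ℕ} (A B : Matrix (Fin n) (Fin n) ℝ)
    (hA : A.PosSemidef) (hB : B.PosSemidef)
    (β γ : ℝ) (hβ0 : 0 < β) (hβ : β < 1 / 2) (hγ0 : 0 < γ) (hγ : γ < 1 / 2)
    (h : ∀ x : Fin n → ℝ,
      (1 / (1 + γ)) * (x ⬝ᵥ ((A + β • B) *ᵥ x)) ≤ (1 + β) * (x ⬝ᵥ (B *ᵥ x)) ∧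
      (1 + β) * (x ⬝ᵥ (B *ᵥ x)) ≤ (1 + γ) * (x ⬝ᵥ ((A + β • B) *ᵥ x))) :
    ∀ x : Fin n → ℝ,
      (1 / ((1 + β) * (1 + γ))) * (x ⬝ᵥ (A *ᵥ x)) ≤ x ⬝ᵥ (B *ᵥ x) ∧
      x ⬝ᵥ (B *ᵥ x) ≤ (1 + β) * (1 + γ) * (x ⬝ᵥ (A *ᵥ x)) := by
  intro x
  have hb : 0 ≤ x ⬝ᵥ (B *ᵥ x) := by
    simpa using hB.dotProduct_mulVec_nonneg x
  obtain ⟨h1, h2⟩ := h x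
  have e : x ⬝ᵥ ((A + β • B) *ᵥ x) = x ⬝ᵥ (A *ᵥ x) + β * (x ⬝ᵥ (B *ᵥ x)) := by
    rw [Matrix.add_mulVec, Matrix.smul_mulVec, dotProduct_add, dotProduct_smul, smul_eq_mul]
  rw [e] at h1 h2
  generalize x ⬝ᵥ (A *ᵥ x) = a at *
  generalize x ⬝ᵥ (B *ᵥ x) = b at *
  constructor
  · rw [one_div, inv_mul_le_iff₀ (by positivity)] at h1 ⊢
    have : 0 ≤ β * b := by positivity
    linarith
  · have h3 : b * (1 - γ * β) ≤ (1 + γ) * a := by linarith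
    have h4 := mul_le_mul_of_nonneg_left h3 (by linarith : 0 ≤ 1 + β)
    have h5 : 0 ≤ 1 - γ - γ * β := by nlinarith
    have h6 : 0 ≤ b * β * (1 - γ - γ * β) := by positivity
    linarith
end

section
/- Let (S, F) be a finite unweighted graph with no isolated vertices, and let d_i denote the degree of vertex i. Then |S|/2 ≤ Σ_{(i,j) ∈ F} 1/min(d_i, d_j) ≤ |S|, where the sum is over the (unordered) edges of F. -/
theorem stmt14_key {n : ℕ} (G : SimpleGraph (Fin n)) [DecidableRel G.Adj]
    (hdeg : ∀ v, 0 < G.degree v) :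
    (∑ e ∈ Finset.univ.filter (fun e : Fin n × Fin n => e.1 < e.2 ∧ G.Adj e.1 e.2),
      ((1 : ℝ) / G.degree e.1 + 1 / G.degree e.2)) = n := by
  have h1 : ∀ i : Fin n, (∑ j : Fin n, if G.Adj i j then (1 : ℝ) / G.degree i else 0) = 1 := by
    intro i
    rw [← Finset.sum_filter, Finset.sum_const, ← SimpleGraph.neighborFinset_eq_filter,
      SimpleGraph.card_neighborFinset_eq_degree, nsmul_eq_mul]
    have : (G.degree i : ℝ) ≠ 0 := by exact_mod_cast (hdeg i).ne'
    field_simp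
  have h2 : (n : ℝ) = ∑ i : Fin n, ∑ j : Fin n,
      if G.Adj i j then (1 : ℝ) / G.degree i else 0 := by
    simp only [h1]
    simp
  rw [Finset.sum_filter, Fintype.sum_prod_type, h2]
  have h3 : ∀ i j : Fin n, (if i < j ∧ G.Adj i j then
      (1 : ℝ) / G.degree i + 1 / G.degree j else 0) =
      (if i < j ∧ G.Adj i j then (1 : ℝ) / G.degree i else 0) +
      (if i < j ∧ G.Adj i j then (1 : ℝ) / G.degree j else 0) := by
    intro i j
    split_ifs <;> simp
  simp only [h3, Finset.sum_add_distrib]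
  rw [Finset.sum_comm (f := fun i j : Fin n =>
    if i < j ∧ G.Adj i j then (1 : ℝ) / G.degree j else 0)]
  simp only [← Finset.sum_add_distrib]
  refine Finset.sum_congr rfl fun i _ => Finset.sum_congr rfl fun j _ => ?_
  by_cases h : G.Adj i j
  · have h' := h.symm
    rcases lt_or_gt_of_ne h.ne with hl | hl
    · simp [h, hl, hl.le]
    · simp [h, h', hl, hl.le]
  · have h' : ¬ G.Adj j i := fun a => h a.symm
    simp [h, h']

/--
In a finite unweighted graph with no isolated vertices
(vertex set `Fin n`), with `d_i` the degree of vertex `i`,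
`n/2 ≤ Σ_{(i,j)∈F} 1/min(d_i,d_j) ≤ n`,
where the sum ranges over the unordered edges, represented as ordered pairs
`(i,j)` with `i < j`.
-/
theorem stmt14 {n : ℕ} (G : SimpleGraph (Fin n)) [DecidableRel G.Adj]
    (hdeg : ∀ v, 0 < G.degree v) :
    (n : ℝ) / 2 ≤
        (∑ e ∈ Finset.univ.filter (fun e : Fin n × Fin n => e.1 < e.2 ∧ G.Adj e.1 e.2),
          (1 : ℝ) / (min (G.degree e.1) (G.degree e.2) : ℕ)) ∧
      (∑ e ∈ Finset.univ.filter (fun e : Fin n × Fin n => e.1 < e.2 ∧ G.Adj e.1 e.2),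
          (1 : ℝ) / (min (G.degree e.1) (G.degree e.2) : ℕ)) ≤ (n : ℝ) := by
  have hk := stmt14_key G hdeg
  constructor
  · rw [← hk, Finset.sum_div]
    refine Finset.sum_le_sum fun e _ => ?_
    have a : (0 : ℝ) < ((min (G.degree e.1) (G.degree e.2) : ℕ) : ℝ) := by
      exact_mod_cast lt_min (hdeg _) (hdeg _)
    have b := one_div_le_one_div_of_le a
      (Nat.cast_le.mpr (min_le_left (G.degree e.1) (G.degree e.2)))
    have c := one_div_le_one_div_of_le a
      (Nat.cast_le.mpr (min_le_right (G.degree e.1) (G.degree e.2)))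
    linarith
  · refine le_trans (Finset.sum_le_sum fun e _ => ?_) hk.le
    have a : (0 : ℝ) ≤ 1 / (G.degree e.1 : ℝ) := by positivity
    have b : (0 : ℝ) ≤ 1 / (G.degree e.2 : ℝ) := by positivity
    rcases min_choice (G.degree e.1) (G.degree e.2) with h | h <;> rw [h] <;> linarith
end
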